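/- There exists a universal constant C > 0 with the following property. Let d, k, T, m ≥ 1 be integers, let δ ∈ (0,1), and let D be a probability measure on ([−1,1]^d) × {1,…,k}. For a matrix W ∈ ℝ^{k×d}, define the predictor h_W(x) = the smallest index y maximizing (Wx)_y. Then, with probability at least 1 − δ over a sample S = ((x_1,y_1),…,(x_m,y_m)) drawn i.i.d. from D, every matrix W ∈ ℝ^{k×d} having at most T nonzero columns satisfies D({(x,y) : h_W(x) ≠ y}) ≤ (1/m)·|{i : h_W(x_i) ≠ y_i}| + C·√((T k log(Tk) log(k) + T log(d) + log(1/δ)) / m). -/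

import Mathlib

open scoped BigOperators
open MeasureTheory

namespace SMG

/-- Sign attached to a Boolean. -/
noncomputable def sg (b : Bool) : ℝ := if b then 1 else -1

lemma rademacher_mgf (m : ℕ) (a : Fin m → ℝ) :
    ∑ σ : Fin m → Bool, Real.exp (∑ i, sg (σ i) * a i)
      ≤ 2 ^ m * Real.exp ((∑ i, a i ^ 2) / 2) := by
  have h1 : ∑ σ : Fin m → Bool, Real.exp (∑ i, sg (σ i) * a i)
      = ∏ i : Fin m, ∑ b : Bool, Real.exp (sg b * a i) := by
    rw [Finset.prod_univ_sum]
    rw [Fintype.piFinset_univ]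
    exact Finset.sum_congr rfl fun σ _ => Real.exp_sum _ _
  rw [h1]
  have h2 : ∀ i : Fin m, ∑ b : Bool, Real.exp (sg b * a i) ≤ 2 * Real.exp (a i ^ 2 / 2) := by
    intro i
    have := Real.cosh_le_exp_half_sq (a i)
    rw [Real.cosh_eq] at this
    simp [sg]
    linarith
  calc _ ≤ ∏ i : Fin m, (2 * Real.exp (a i ^ 2 / 2)) :=
        Finset.prod_le_prod (fun i _ => Finset.sum_nonneg fun b _ => (Real.exp_pos _).le)
          (fun i _ => h2 i)
    _ = _ := by
        rw [Finset.prod_mul_distrib, ← Real.exp_sum, Finset.sum_div]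
        simp

lemma rademacher_tail (m : ℕ) (a : Fin m → ℝ) (v t : ℝ) (hv : 0 < v) (ht : 0 ≤ t)
    (ha : ∑ i, a i ^ 2 ≤ v) :
    ((Finset.univ.filter fun σ : Fin m → Bool => t < ∑ i, sg (σ i) * a i).card : ℝ)
      ≤ 2 ^ m * Real.exp (-(t ^ 2 / (2 * v))) := by
  set l := t / v with hl
  have hl0 : 0 ≤ l := by positivity
  have h1 := rademacher_mgf m (fun i => l * a i)
  have h2 : ((Finset.univ.filter fun σ : Fin m → Bool => t < ∑ i, sg (σ i) * a i).card : ℝ)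
      * Real.exp (l * t) ≤ ∑ σ : Fin m → Bool, Real.exp (∑ i, sg (σ i) * (l * a i)) := by
    rw [← nsmul_eq_mul, ← Finset.sum_const]
    refine (Finset.sum_le_sum ?_).trans
      (Finset.sum_le_sum_of_subset_of_nonneg (Finset.filter_subset _ _)
        (fun _ _ _ => (Real.exp_pos _).le))
    intro σ hσ
    have hσ' := (Finset.mem_filter.1 hσ).2
    apply Real.exp_le_exp.2
    have : ∑ i, sg (σ i) * (l * a i) = l * ∑ i, sg (σ i) * a i := by
      rw [Finset.mul_sum]; exact Finset.sum_congr rfl fun i _ => by ring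
    rw [this]
    exact mul_le_mul_of_nonneg_left hσ'.le hl0
  have h3 : (∑ i, (l * a i) ^ 2) / 2 ≤ l ^ 2 * v / 2 := by
    have : ∑ i, (l * a i) ^ 2 = l ^ 2 * ∑ i, a i ^ 2 := by
      rw [Finset.mul_sum]; exact Finset.sum_congr rfl fun i _ => by ring
    rw [this]
    have := mul_le_mul_of_nonneg_left ha (sq_nonneg l)
    linarith
  have h4 := h2.trans (h1.trans (mul_le_mul_of_nonneg_left (Real.exp_le_exp.2 h3)
    (by positivity)))
  have h5 : -(t ^ 2 / (2 * v)) = l ^ 2 * v / 2 - l * t := by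
    rw [hl]; field_simp; ring
  rw [h5, Real.exp_sub, ← mul_div_assoc, le_div_iff₀ (Real.exp_pos _)]
  exact h4

/-- Trace of `B` on the points `x`. -/
def tr {ι : Type*} [DecidableEq ι] {r : ℕ} (x : Fin r → ι) (B : Finset ι) : Finset (Fin r) :=
  Finset.univ.filter fun i => x i ∈ B

lemma tr_eq_card {ι : Type*} [DecidableEq ι] [Fintype ι] (r : ℕ) (B C : Finset ι) (ε : ℝ)
    (h : ε * Fintype.card ι ≤ (symmDiff B C).card) (hε : ε ≤ 1) :
    ((Finset.univ.filter fun x : Fin r → ι => tr x B = tr x C).card : ℝ)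
      ≤ (Fintype.card ι : ℝ) ^ r * Real.exp (-(ε * r)) := by
  have h1 : (Finset.univ.filter fun x : Fin r → ι => tr x B = tr x C)
      = Fintype.piFinset (fun _ : Fin r => (symmDiff B C)ᶜ) := by
    ext x
    simp only [Finset.mem_filter, Finset.mem_univ, true_and, Fintype.mem_piFinset, tr,
      Finset.ext_iff, Finset.mem_compl, Finset.mem_symmDiff]
    refine forall_congr' fun i => ?_
    tauto
  rw [h1, Fintype.card_piFinset]
  simp only [Finset.prod_const, Finset.card_univ, Fintype.card_fin, Nat.cast_pow]
  have h2 : (((symmDiff B C)ᶜ).card : ℝ) ≤ Fintype.card ι * Real.exp (-ε) := by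
    rw [Finset.card_compl, Nat.cast_sub (Finset.card_le_univ _)]
    have := Real.add_one_le_exp (-ε)
    have h0 : (0:ℝ) ≤ Fintype.card ι := by positivity
    nlinarith
  calc _ ≤ (Fintype.card ι * Real.exp (-ε)) ^ r := pow_le_pow_left₀ (by positivity) h2 _
    _ = _ := by
      rw [mul_pow, ← Real.exp_nat_mul]; ring_nf

lemma packing {ι : Type*} [DecidableEq ι] [Fintype ι] [Nonempty ι] (N : Finset (Finset ι))
    (ε : ℝ) (hε : 0 < ε) (hε1 : ε ≤ 1) (A V : ℕ) (hA : 1 ≤ A) (hV : 1 ≤ V)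
    (hsep : ∀ B ∈ N, ∀ C ∈ N, B ≠ C → ε * Fintype.card ι ≤ (symmDiff B C).card)
    (hgr : ∀ r : ℕ, 1 ≤ r → ∀ x : Fin r → ι, (N.image (tr x)).card ≤ (A * r) ^ V) :
    Real.log N.card ≤ 2 * V * Real.log (6 * A * V / ε) := by
  have hA' : (1:ℝ) ≤ A := by exact_mod_cast hA
  have hV' : (1:ℝ) ≤ V := by exact_mod_cast hV
  have hK : 1 < Real.log (6 * A * V / ε) := by
    rw [Real.lt_log_iff_exp_lt (by positivity)]
    refine (Real.exp_one_lt_d9.trans (by norm_num : _ < (6:ℝ))).trans_le ?_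
    rw [le_div_iff₀ hε]
    nlinarith [mul_le_mul hA' hV' (by norm_num) (by positivity)]
  by_cases hL : Real.log N.card < 1
  · nlinarith
  push Not at hL
  set L := Real.log N.card with hLdef
  have hN0 : (0:ℝ) < N.card := by
    rcases Nat.eq_zero_or_pos N.card with h | h
    · rw [h] at hLdef; simp at hLdef; linarith
    · exact_mod_cast h
  set r := ⌊2 * L / ε⌋₊ + 1 with hr
  have hr1 : 1 ≤ r := by omega
  have hr2 : 2 * L / ε < r := by rw [hr]; push_cast; exact Nat.lt_floor_add_one _
  have hr3 : (r:ℝ) ≤ 2 * L / ε + 1 := by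
    rw [hr]; push_cast
    linarith [Nat.floor_le (show 0 ≤ 2 * L / ε by positivity)]
  -- exists x separating
  have hx : ∃ x : Fin r → ι, Set.InjOn (tr x) (N : Set (Finset ι)) := by
    by_contra hcon
    push Not at hcon
    have hcov : (Finset.univ : Finset (Fin r → ι)) ⊆ (N.offDiag).biUnion
        (fun p => Finset.univ.filter fun x : Fin r → ι => tr x p.1 = tr x p.2) := by
      intro x _
      have := hcon x
      simp only [Set.InjOn] at this
      push Not at this
      obtain ⟨B, hB, C, hC, h1, h2⟩ := this
      simp only [Finset.mem_biUnion, Finset.mem_offDiag, Finset.mem_filter, Finset.mem_univ,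
        true_and]
      exact ⟨(B, C), ⟨hB, hC, h2⟩, h1⟩
    have h1 := (Finset.card_le_card hcov).trans Finset.card_biUnion_le
    have h2 : ((Fintype.card ι : ℝ)) ^ r ≤ ∑ p ∈ N.offDiag,
        (Fintype.card ι : ℝ) ^ r * Real.exp (-(ε * r)) := by
      have : ((Fintype.card ι : ℝ)) ^ r = ((Finset.univ : Finset (Fin r → ι)).card : ℝ) := by
        simp
      rw [this]
      refine (Nat.cast_le.2 h1).trans ?_
      push_cast
      rw [← this]
      refine Finset.sum_le_sum fun p hp => ?_
      rw [Finset.mem_offDiag] at hp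
      exact tr_eq_card r p.1 p.2 ε (hsep _ hp.1 _ hp.2.1 hp.2.2) hε1
    rw [Finset.sum_const, nsmul_eq_mul] at h2
    have hc : (0:ℝ) < (Fintype.card ι : ℝ) ^ r := by
      have := Fintype.card_pos (α := ι)
      positivity
    have h3 : (N.offDiag.card : ℝ) ≤ (N.card : ℝ) ^ 2 := by
      rw [Finset.offDiag_card]
      have : N.card * N.card - N.card ≤ N.card ^ 2 := by rw [sq]; omega
      exact_mod_cast this
    have h4 : Real.exp (-(ε * r)) * (N.card:ℝ) ^ 2 < 1 := by
      have : (N.card : ℝ) = Real.exp L := by rw [hLdef, Real.exp_log hN0]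
      rw [this, ← Real.exp_nat_mul, ← Real.exp_add, Real.exp_lt_one_iff]
      rw [div_lt_iff₀ hε] at hr2
      push_cast
      linarith
    have he := Real.exp_pos (-(ε * r))
    have h5 : (N.offDiag.card : ℝ) * Real.exp (-(ε * r)) < 1 := by
      nlinarith
    nlinarith
  obtain ⟨x, hx⟩ := hx
  have hcard : N.card ≤ (A * r) ^ V := by
    rw [← Finset.card_image_of_injOn hx]
    exact hgr r hr1 x
  have hcard' : (N.card : ℝ) ≤ ((A:ℝ) * r) ^ V := by exact_mod_cast hcard
  have hlog : L ≤ V * Real.log (A * r) := by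
    rw [hLdef, ← Real.log_pow]
    exact Real.log_le_log hN0 hcard'
  have hAr : (A:ℝ) * r ≤ (6 * A * V / ε) * (L / (2 * V)) := by
    have : (6 * A * V / ε) * (L / (2 * V)) = A * (3 * L / ε) := by field_simp; ring
    rw [this]
    apply mul_le_mul_of_nonneg_left _ (by positivity)
    refine hr3.trans ?_
    have : 1 ≤ L / ε := by rw [le_div_iff₀ hε]; linarith
    have e1 : 2 * L / ε = 2 * (L / ε) := by ring
    have e2 : 3 * L / ε = 3 * (L / ε) := by ring
    rw [e1, e2]; linarith
  have hL0 : 0 < L := by linarith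
  have h6 : Real.log (A * r) ≤ Real.log (6 * A * V / ε) + L / (2 * V) := by
    have hr0 : (0:ℝ) < r := by exact_mod_cast hr1
    refine (Real.log_le_log (by positivity) hAr).trans ?_
    rw [Real.log_mul (by positivity) (by positivity)]
    have := Real.log_le_sub_one_of_pos (show 0 < L / (2 * V) by positivity)
    linarith
  have h7 : L ≤ V * Real.log (6 * A * V / ε) + L / 2 := by
    refine hlog.trans ((mul_le_mul_of_nonneg_left h6 (by positivity)).trans (le_of_eq ?_))
    field_simp
  linarith

lemma exists_net {ι : Type*} [DecidableEq ι] (F : Finset (Finset ι)) (ρ : ℝ) :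
    ∃ N ⊆ F, (∀ B ∈ N, ∀ C ∈ N, B ≠ C → ρ < (symmDiff B C).card) ∧
      ∀ B ∈ F, ∃ C ∈ N, (B = C ∨ ((symmDiff B C).card : ℝ) ≤ ρ) := by
  classical
  obtain ⟨N, hN, hmax⟩ := Finset.exists_max_image
    (F.powerset.filter fun N => ∀ B ∈ N, ∀ C ∈ N, B ≠ C → ρ < (symmDiff B C).card)
    Finset.card ⟨∅, by simp⟩
  simp only [Finset.mem_filter, Finset.mem_powerset] at hN hmax
  refine ⟨N, hN.1, hN.2, fun B hB => ?_⟩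
  by_contra hcon
  push Not at hcon
  have hBN : B ∉ N := fun h => (hcon B h).1 rfl
  have := hmax (insert B N) ⟨Finset.insert_subset hB hN.1, ?_⟩
  · rw [Finset.card_insert_of_notMem hBN] at this; omega
  · intro C hC E hE hne
    rw [Finset.mem_insert] at hC hE
    rcases hC with rfl | hC <;> rcases hE with rfl | hE
    · exact absurd rfl hne
    · exact (hcon E hE).2
    · rw [symmDiff_comm]; exact (hcon C hC).2
    · exact hN.2 C hC E hE hne

/-- The symmetrized process. -/
noncomputable def ind {ι : Type*} [DecidableEq ι] (B : Finset ι) (i : ι) : ℝ := if i ∈ B then 1 else 0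

noncomputable def X {m : ℕ} (σ : Fin m → Bool) (B : Finset (Fin m × Bool)) : ℝ :=
  ∑ i, sg (σ i) * (ind B (i, true) - ind B (i, false))

lemma incr_sq {m : ℕ} (B C : Finset (Fin m × Bool)) :
    ∑ i, ((ind B (i, true) - ind B (i, false)) - (ind C (i, true) - ind C (i, false))) ^ 2
      ≤ 2 * (symmDiff B C).card := by
  have h1 : ((symmDiff B C).card : ℝ) = ∑ q : Fin m × Bool, (ind B q - ind C q) ^ 2 := by
    rw [Finset.card_eq_sum_ones, Nat.cast_sum,
      ← Finset.sum_subset (Finset.subset_univ (symmDiff B C))]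
    · refine Finset.sum_congr rfl fun q hq => ?_
      rw [Finset.mem_symmDiff] at hq
      rcases hq with h | h <;> simp [ind, h.1, h.2]
    · intro q _ hq
      rw [Finset.mem_symmDiff] at hq
      by_cases h1 : q ∈ B <;> by_cases h2 : q ∈ C <;> simp_all [ind]
  rw [h1, Fintype.sum_prod_type, Finset.mul_sum]
  refine Finset.sum_le_sum fun i _ => ?_
  rw [Fintype.sum_bool]
  nlinarith [sq_nonneg ((ind B (i, true) - ind C (i,true)) + (ind B (i, false) - ind C (i,false)))]

lemma X_sub {m : ℕ} (σ : Fin m → Bool) (B C : Finset (Fin m × Bool)) :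
    X σ B - X σ C = ∑ i, sg (σ i) *
      ((ind B (i, true) - ind B (i, false)) - (ind C (i, true) - ind C (i, false))) := by
  simp only [X]
  rw [← Finset.sum_sub_distrib]
  exact Finset.sum_congr rfl fun i _ => by ring

lemma geo_sum (J : ℕ) : ∑ j ∈ Finset.range (J + 1), ((j:ℝ) + 1) * (1/2) ^ j
    = 4 - (J + 3) * (1/2) ^ J := by
  induction J with
  | zero => simp; norm_num
  | succ n ih => rw [Finset.sum_range_succ, ih]; push_cast; ring

lemma geo_sum' (J : ℕ) : ∑ j ∈ Finset.range (J + 1), ((1:ℝ)/2) ^ (j+1)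
    = 1 - (1/2) ^ (J+1) := by
  induction J with
  | zero => simp; norm_num
  | succ n ih => rw [Finset.sum_range_succ, ih]; ring

set_option maxHeartbeats 1000000 in
lemma chaining (m : ℕ) (hm : 1 ≤ m) (F : Finset (Finset (Fin m × Bool))) (A V : ℕ)
    (hA : 1 ≤ A) (hV : 1 ≤ V)
    (hgr : ∀ r : ℕ, 1 ≤ r → ∀ x : Fin r → Fin m × Bool, (F.image (tr x)).card ≤ (A * r) ^ V)
    (δ : ℝ) (hδ : 0 < δ) (hδ1 : δ < 1) :
    ((Finset.univ.filter fun σ : Fin m → Bool => ∃ B ∈ F,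
      32 * Real.sqrt (m * (2 * V * Real.log (6 * A * V) + Real.log (1 / δ))) < X σ B).card : ℝ)
      ≤ δ * 2 ^ m := by
  classical
  have hm' : (1:ℝ) ≤ m := by exact_mod_cast hm
  have hA' : (1:ℝ) ≤ A := by exact_mod_cast hA
  have hV' : (1:ℝ) ≤ V := by exact_mod_cast hV
  have hAV : (1:ℝ) ≤ A * V := by nlinarith
  have : Nonempty (Fin m × Bool) := ⟨(⟨0, hm⟩, true)⟩
  have hcard : (Fintype.card (Fin m × Bool) : ℝ) = 2 * m := by simp; ring
  set K : ℝ := 6 * A * V with hK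
  have hK6 : 6 ≤ K := by rw [hK]; nlinarith
  have hlogK : Real.log 4 ≤ Real.log K := Real.log_le_log (by norm_num) (by linarith)
  have hlog4 : Real.log 4 = 2 * Real.log 2 := by
    rw [show (4:ℝ) = 2 ^ 2 by norm_num, Real.log_pow]; norm_num
  have hlog2 : 0 < Real.log 2 := Real.log_pos (by norm_num)
  have hlogd : 0 < Real.log (1 / δ) := Real.log_pos (by rw [lt_div_iff₀ hδ]; linarith)
  set E : ℝ := 2 * V * Real.log K + Real.log (1 / δ) with hE
  have hE2 : Real.log 2 ≤ E := by rw [hE]; nlinarith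
  have hE0 : 0 < E := by linarith
  choose net hsub hsep hcov using fun j : ℕ => exists_net F ((1/4:ℝ) ^ j * (2 * m))
  have hcov' : ∀ j B, ∃ C, B ∈ F → C ∈ net j ∧
      ((symmDiff B C).card : ℝ) ≤ (1/4:ℝ) ^ j * (2 * m) := by
    intro j B
    by_cases hB : B ∈ F
    · obtain ⟨C, hC, h⟩ := hcov j B hB
      refine ⟨C, fun _ => ⟨hC, ?_⟩⟩
      rcases h with rfl | h
      · simp
      · exact h
    · exact ⟨∅, fun h => absurd h hB⟩
  choose pr hpr using hcov'
  let par : ℕ → Finset (Fin m × Bool) → Finset (Fin m × Bool) := fun j B =>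
    match j with
    | 0 => ∅
    | j + 1 => pr j B
  set s := Real.sqrt (m * E) with hs
  have hs0 : 0 < s := Real.sqrt_pos.2 (by positivity)
  have hss : s ^ 2 = m * E := Real.sq_sqrt (by positivity)
  let t : ℕ → ℝ := fun j => 8 * s * (((j:ℝ) + 1) * (1/2) ^ j)
  let bad : ℕ → Finset (Fin m → Bool) := fun j =>
    (net j).biUnion fun B => Finset.univ.filter fun σ => t j < X σ B - X σ (par j B)
  have hdist : ∀ j, ∀ B ∈ net j, (2 * (symmDiff B (par j B)).card : ℝ) ≤ 16 * m * (1/4) ^ j := by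
    intro j B hB
    cases j with
    | zero =>
      have h : ((symmDiff B (par 0 B)).card : ℝ) ≤ 2 * m := by
        rw [← hcard]; exact_mod_cast Finset.card_le_univ _
      simp; linarith
    | succ j =>
      have := (hpr j B (hsub _ hB)).2
      rw [pow_succ]
      change (2 * (symmDiff B (pr j B)).card : ℝ) ≤ _
      linarith
  have hN : ∀ j : ℕ, Real.log (net j).card ≤ 2 * V * (Real.log K + j * Real.log 4) := by
    intro j
    have h := packing (net j) ((1/4:ℝ)^j) (by positivity)
      (pow_le_one₀ (by norm_num) (by norm_num)) A V hA hV
      (fun B hB C hC hne => by rw [hcard]; exact (hsep j B hB C hC hne).le)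
      (fun r hr x => (Finset.card_le_card (Finset.image_subset_image (hsub j))).trans (hgr r hr x))
    refine h.trans (le_of_eq ?_)
    rw [← hK, Real.log_div (by positivity) (by positivity), Real.log_pow,
      one_div, Real.log_inv]
    ring
  have hbad : ∀ j, ((bad j).card : ℝ) ≤ 2 ^ m * (δ * (1/2) ^ (j+1)) := by
    intro j
    have h1 : ((bad j).card : ℝ) ≤ ∑ B ∈ net j, 2 ^ m * Real.exp (-(2 * E * ((j:ℝ)+1)^2)) := by
      refine (Nat.cast_le.2 Finset.card_biUnion_le).trans ?_
      push_cast
      refine Finset.sum_le_sum fun B hB => ?_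
      have h := rademacher_tail m (fun i => (ind B (i, true) - ind B (i, false)) -
        (ind (par j B) (i, true) - ind (par j B) (i, false))) (16 * m * (1/4)^j) (t j)
        (by positivity) (by positivity) ((incr_sq B (par j B)).trans (hdist j B hB))
      simp only [X_sub]
      refine h.trans (le_of_eq ?_)
      congr 2
      have e4 : ((1:ℝ)/4)^j = ((1/2)^j)^2 := by rw [← pow_mul, mul_comm, pow_mul]; norm_num
      simp only [t]
      rw [e4, mul_pow, mul_pow, hss]
      field_simp
      ring
    rw [Finset.sum_const, nsmul_eq_mul] at h1
    rcases Nat.eq_zero_or_pos (net j).card with h0 | h0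
    · rw [h0] at h1
      refine h1.trans ?_
      simp; positivity
    have h0' : (0:ℝ) < (net j).card := by exact_mod_cast h0
    refine h1.trans ?_
    have h2 : ((net j).card : ℝ) = Real.exp (Real.log (net j).card) := (Real.exp_log h0').symm
    have h3 : δ * (1/2:ℝ) ^ (j+1) = Real.exp (-Real.log (1/δ) - (j+1) * Real.log 2) := by
      rw [Real.exp_sub, Real.exp_neg, Real.exp_log (by positivity), mul_comm ((j:ℝ)+1),
        Real.exp_mul, Real.exp_log (by norm_num)]
      have : ((2:ℝ) ^ ((j:ℝ)+1)) = 2 ^ (j+1) := by exact_mod_cast Real.rpow_natCast 2 (j+1)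
      rw [this]; simp; field_simp
    have h4 : ((net j).card : ℝ) * Real.exp (-(2 * E * ((j:ℝ)+1)^2)) ≤ δ * (1/2:ℝ) ^ (j+1) := by
      rw [h2, ← Real.exp_add, h3]
      apply Real.exp_le_exp.2
      have hj : (0:ℝ) ≤ j := by positivity
      have a1 := hN j
      have a2 : (j:ℝ) * Real.log 4 ≤ j * Real.log K := mul_le_mul_of_nonneg_left hlogK hj
      have a3 : Real.log (net j).card ≤ 2 * V * Real.log K * (j + 1) := by
        refine a1.trans ?_
        have : Real.log K + j * Real.log 4 ≤ Real.log K * (j+1) := by linarith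
        have h := mul_le_mul_of_nonneg_left this (show (0:ℝ) ≤ 2 * V by positivity)
        linarith
      have a4 : Real.log (net j).card + Real.log (1/δ) ≤ E * (j+1) := by
        have h := mul_nonneg hj hlogd.le
        rw [hE]; linarith
      have a5 : ((j:ℝ)+1) * Real.log 2 ≤ E * (j+1) := by
        rw [mul_comm]
        exact mul_le_mul_of_nonneg_right hE2 (by positivity)
      have a6 : E * (j+1) ≤ E * (j+1)^2 := by
        apply mul_le_mul_of_nonneg_left _ hE0.le
        nlinarith
      linarith
    calc _ = 2 ^ m * (((net j).card : ℝ) * Real.exp (-(2 * E * ((j:ℝ)+1)^2))) := by ring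
      _ ≤ _ := mul_le_mul_of_nonneg_left h4 (by positivity)
  have hgood : ∀ σ : Fin m → Bool, ∀ J, (∀ j ≤ J, σ ∉ bad j) → ∀ B ∈ net J,
      X σ B ≤ ∑ j ∈ Finset.range (J+1), t j := by
    intro σ J
    induction J with
    | zero =>
      intro h B hB
      have := h 0 le_rfl
      simp only [bad, Finset.mem_biUnion, Finset.mem_filter, Finset.mem_univ, true_and,
        not_exists, not_and, not_lt] at this
      have h2 := this B hB
      have h3 : X σ (par 0 B) = 0 := by simp [par, X, ind]
      simp only [zero_add, Finset.sum_range_one]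
      linarith
    | succ J ih =>
      intro h B hB
      have := h (J+1) le_rfl
      simp only [bad, Finset.mem_biUnion, Finset.mem_filter, Finset.mem_univ, true_and,
        not_exists, not_and, not_lt] at this
      have h2 := this B hB
      have h3 := ih (fun j hj => h j (by omega)) (par (J+1) B) (hpr J B (hsub _ hB)).1
      rw [Finset.sum_range_succ]
      linarith
  have hfull : ∀ B ∈ F, B ∈ net m := by
    intro B hB
    obtain ⟨C, hC, h⟩ := hcov m B hB
    rcases h with rfl | h
    · exact hC
    have h1 : (1/4:ℝ)^m * (2*m) < 1 := by
      have h2 : 2 * m < 4 ^ m := by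
        have a := Nat.lt_two_pow_self (n := m)
        have b : 4 ^ m = 2 ^ m * 2 ^ m := by rw [← mul_pow]; norm_num
        have c : 2 ≤ 2 ^ m := by
          calc 2 = 2 ^ 1 := rfl
            _ ≤ 2 ^ m := Nat.pow_le_pow_right (by norm_num) hm
        nlinarith
      have h3 : (2 * m : ℝ) < 4 ^ m := by exact_mod_cast h2
      rw [one_div, inv_pow, inv_mul_lt_iff₀ (by positivity)]
      linarith
    have h2 : (symmDiff B C).card < 1 := by exact_mod_cast h.trans_lt h1
    have h3 : symmDiff B C = ∅ := by rw [← Finset.card_eq_zero]; omega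
    have h4 : B = C := by
      rw [← Finset.bot_eq_empty, symmDiff_eq_bot] at h3; exact h3
    rw [h4]; exact hC
  have hsum : ∑ j ∈ Finset.range (m+1), t j ≤ 32 * s := by
    simp only [t]
    rw [← Finset.mul_sum, geo_sum]
    have : 0 ≤ ((m:ℝ) + 3) * (1/2)^m := by positivity
    nlinarith
  have hincl : (Finset.univ.filter fun σ : Fin m → Bool => ∃ B ∈ F, 32 * s < X σ B)
      ⊆ (Finset.range (m+1)).biUnion bad := by
    intro σ hσ
    simp only [Finset.mem_filter, Finset.mem_univ, true_and] at hσ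
    obtain ⟨B, hB, hlt⟩ := hσ
    by_contra hcon
    have h1 : ∀ j ≤ m, σ ∉ bad j := by
      intro j hj hb
      exact hcon (Finset.mem_biUnion.2 ⟨j, Finset.mem_range.2 (by omega), hb⟩)
    have := hgood σ m h1 B (hfull B hB)
    linarith
  calc _ ≤ (((Finset.range (m+1)).biUnion bad).card : ℝ) := by
        exact_mod_cast Finset.card_le_card hincl
    _ ≤ ∑ j ∈ Finset.range (m+1), ((bad j).card : ℝ) := by
        exact_mod_cast Finset.card_biUnion_le
    _ ≤ ∑ j ∈ Finset.range (m+1), 2 ^ m * (δ * (1/2) ^ (j+1)) :=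
        Finset.sum_le_sum fun j _ => hbad j
    _ ≤ δ * 2 ^ m := by
        rw [← Finset.mul_sum, ← Finset.mul_sum, geo_sum']
        have : (0:ℝ) ≤ (1/2)^(m+1) := by positivity
        have h2 : (0:ℝ) < 2 ^ m * δ := by positivity
        nlinarith

end SMG

namespace SMG

lemma sum_choose_le (N D : ℕ) : ∑ j ∈ Finset.Iic D, N.choose j ≤ (N + 1) ^ D := by
  rw [← Nat.range_succ_eq_Iic]
  induction D with
  | zero => simp
  | succ D ih =>
    rw [Finset.sum_range_succ]
    have h1 := Nat.choose_le_pow N (D+1)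
    have h2 : N ^ D ≤ (N+1) ^ D := Nat.pow_le_pow_left (by omega) D
    have h3 : N ^ (D+1) ≤ (N+1) ^ D * N := by rw [pow_succ]; exact Nat.mul_le_mul_right _ h2
    rw [pow_succ (N+1)]
    linarith

lemma halfspace_patterns {ι κ : Type} [Fintype ι] [Fintype κ] [DecidableEq κ] (v : κ → ι → ℝ)
    (F : Finset (Finset κ))
    (hF : ∀ B ∈ F, ∃ u : ι → ℝ, ∀ q, q ∈ B ↔ 0 ≤ ∑ i, u i * v q i) :
    F.card ≤ (Fintype.card κ + 1) ^ Fintype.card ι := by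
  have hvc : F.vcDim ≤ Fintype.card ι := by
    refine Finset.sup_le fun s hs => ?_
    rw [Finset.mem_shatterer] at hs
    by_contra hcon
    push Not at hcon
    have hdep : ¬ LinearIndependent ℝ (fun q : s => v q) := by
      intro h
      have := h.fintype_card_le_finrank
      simp at this
      omega
    rw [Fintype.not_linearIndependent_iff] at hdep
    have hdep' : ∃ g : s → ℝ, ∑ q, g q • v q = 0 ∧ ∃ q, g q < 0 := by
      obtain ⟨g, hg, q, hq⟩ := hdep
      rcases lt_or_gt_of_ne hq with h | h
      · exact ⟨g, hg, q, h⟩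
      · refine ⟨fun q => - g q, ?_, q, by simpa using h⟩
        simp only [neg_smul, Finset.sum_neg_distrib, hg, neg_zero]
    obtain ⟨g, hg, q0, hq0⟩ := hdep'
    obtain ⟨B, hB, hsB⟩ := hs (t := s.filter fun q => ∃ h : q ∈ s, 0 ≤ g ⟨q, h⟩)
      (Finset.filter_subset _ _)
    obtain ⟨u, hu⟩ := hF B hB
    have key : ∀ q : s, (0 ≤ ∑ i, u i * v q i ↔ 0 ≤ g q) := by
      intro q
      rw [← hu]
      have := Finset.ext_iff.1 hsB q
      simp only [Finset.mem_inter, Finset.mem_filter, q.2, true_and] at this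
      rw [this]
      simp
    have hz : ∑ q, g q * ∑ i, u i * v q i = 0 := by
      have h1 : ∑ q, g q * ∑ i, u i * v q i = ∑ i, u i * (∑ q, g q • v q) i := by
        simp only [Finset.mul_sum, Finset.sum_apply, Pi.smul_apply, smul_eq_mul]
        rw [Finset.sum_comm]
        exact Finset.sum_congr rfl fun i _ => Finset.sum_congr rfl fun q _ => by ring
      rw [h1, hg]; simp
    have hpos : 0 < ∑ q, g q * ∑ i, u i * v q i := by
      refine Finset.sum_pos' (fun q _ => ?_) ⟨q0, Finset.mem_univ _, ?_⟩
      · by_cases h : 0 ≤ g q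
        · exact mul_nonneg h ((key q).2 h)
        · have h' := mt (key q).1 h
          push Not at h h'
          exact (mul_pos_of_neg_of_neg h h').le
      · have h' := mt (key q0).1 (not_le.2 hq0)
        push Not at h'
        exact mul_pos_of_neg_of_neg hq0 h'
    linarith
  calc F.card ≤ F.shatterer.card := Finset.card_le_card_shatterer F
    _ ≤ ∑ j ∈ Finset.Iic F.vcDim, (Fintype.card κ).choose j := Finset.card_shatterer_le_sum_vcDim
    _ ≤ (Fintype.card κ + 1) ^ F.vcDim := sum_choose_le _ _
    _ ≤ _ := Nat.pow_le_pow_right (by omega) hvc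

/-- Pattern of membership of the points `z` in `H`. -/
noncomputable def pat {ι Ω : Type*} [Fintype ι] (z : ι → Ω) (H : Set Ω) : Finset ι := by
  classical exact Finset.univ.filter fun i => z i ∈ H

lemma mem_pat {ι Ω : Type*} [Fintype ι] (z : ι → Ω) (H : Set Ω) (i : ι) :
    i ∈ pat z H ↔ z i ∈ H := by
  classical simp [pat]

/-- Expand reduced parameters to a full matrix. -/
noncomputable def WU {d k T : ℕ} (f : Fin T → Fin d) (U : Fin k × Fin T → ℝ) :
    Fin k → Fin d → ℝ :=
  fun y j => ∑ t, if f t = j then U (y, t) else 0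

lemma WU_score {d k T : ℕ} (f : Fin T → Fin d) (U : Fin k × Fin T → ℝ) (y : Fin k)
    (x : Fin d → ℝ) : ∑ j, WU f U y j * x j = ∑ t, U (y, t) * x (f t) := by
  simp only [WU, Finset.sum_mul]
  rw [Finset.sum_comm]
  refine Finset.sum_congr rfl fun t _ => ?_
  simp

/-- The defining property of the predictor. -/
def IsPred {d k : ℕ} (pred : (Fin k → Fin d → ℝ) → (Fin d → ℝ) → Fin k) : Prop :=
  ∀ (W : Fin k → Fin d → ℝ) (x : Fin d → ℝ),
        (∀ y : Fin k, (∑ j, W y j * x j) ≤ ∑ j, W (pred W x) j * x j) ∧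
        (∀ y : Fin k, (∀ y' : Fin k, (∑ j, W y' j * x j) ≤ ∑ j, W y j * x j) →
          pred W x ≤ y)

lemma pred_eq_iff {d k : ℕ} {pred : (Fin k → Fin d → ℝ) → (Fin d → ℝ) → Fin k}
    (hp : IsPred pred) (W : Fin k → Fin d → ℝ) (x : Fin d → ℝ) (y : Fin k) :
    pred W x = y ↔ (∀ y', (∑ j, W y' j * x j) ≤ ∑ j, W y j * x j) ∧
      ∀ y' < y, (∑ j, W y' j * x j) < ∑ j, W y j * x j := by
  obtain ⟨h1, h2⟩ := hp W x
  constructor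
  · rintro rfl
    refine ⟨h1, fun y' hy' => ?_⟩
    by_contra hcon
    push Not at hcon
    exact absurd (h2 y' fun y'' => (h1 y'').trans hcon) (not_le.2 hy')
  · rintro ⟨h3, h4⟩
    refine le_antisymm (h2 y h3) ?_
    by_contra hcon
    push Not at hcon
    exact absurd (h1 y) (not_le.2 (h4 _ hcon))

/-- Error set. -/
def errSet {d k : ℕ} (pred : (Fin k → Fin d → ℝ) → (Fin d → ℝ) → Fin k)
    (W : Fin k → Fin d → ℝ) : Set ((Fin d → ℝ) × Fin k) := {p | pred W p.1 ≠ p.2}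

lemma growth {d k T : ℕ} (hk : 1 ≤ k) {pred : (Fin k → Fin d → ℝ) → (Fin d → ℝ) → Fin k}
    (hp : IsPred pred) (f : Fin T → Fin d) (r : ℕ) (hr : 1 ≤ r)
    (z : Fin r → (Fin d → ℝ) × Fin k) :
    (Set.range fun U : Fin k × Fin T → ℝ => pat z (errSet pred (WU f U))).ncard
      ≤ (2 * k ^ 2 * r) ^ (k * T) := by
  classical
  let v : Fin r × Fin k × Fin k → Fin k × Fin T → ℝ := fun q a =>
    ((if a.1 = q.2.1 then 1 else 0) - (if a.1 = q.2.2 then 1 else 0)) * (z q.1).1 (f a.2)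
  have hv : ∀ U q, ∑ a, U a * v q a =
      (∑ j, WU f U q.2.1 j * (z q.1).1 j) - ∑ j, WU f U q.2.2 j * (z q.1).1 j := by
    intro U q
    rw [WU_score, WU_score, Fintype.sum_prod_type]
    simp only [v, sub_mul, mul_sub, Finset.sum_sub_distrib, ite_mul, one_mul, zero_mul, mul_ite,
      mul_zero]
    congr 1
    · rw [Finset.sum_comm]; simp
    · rw [Finset.sum_comm]; simp
  let P : (Fin k × Fin T → ℝ) → Finset (Fin r × Fin k × Fin k) := fun U =>
    Finset.univ.filter fun q => 0 ≤ ∑ a, U a * v q a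
  have hfac : ∀ U U', P U = P U' →
      pat z (errSet pred (WU f U)) = pat z (errSet pred (WU f U')) := by
    intro U U' h
    have h1 : ∀ i y y', (∑ j, WU f U y' j * (z i).1 j ≤ ∑ j, WU f U y j * (z i).1 j ↔
        ∑ j, WU f U' y' j * (z i).1 j ≤ ∑ j, WU f U' y j * (z i).1 j) := by
      intro i y y'
      have := Finset.ext_iff.1 h (i, y, y')
      simp only [P, Finset.mem_filter, Finset.mem_univ, true_and, hv, sub_nonneg] at this
      exact this
    have h2 : ∀ i, pred (WU f U) (z i).1 = pred (WU f U') (z i).1 := by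
      intro i
      rw [pred_eq_iff hp]
      obtain ⟨a, b⟩ := (pred_eq_iff hp (WU f U') (z i).1 _).1 rfl
      refine ⟨fun y' => (h1 _ _ _).2 (a y'), fun y' hy' => ?_⟩
      have := b y' hy'
      rw [← not_le] at this ⊢
      rwa [h1]
    ext i
    rw [mem_pat, mem_pat]
    simp only [errSet, Set.mem_ofPred_eq, h2]
  have hFin : (Set.range P).Finite := Set.toFinite _
  have hle : (Set.range fun U : Fin k × Fin T → ℝ => pat z (errSet pred (WU f U))).ncard
      ≤ (Set.range P).ncard := by
    let h : Finset (Fin r × Fin k × Fin k) → Finset (Fin r) := fun B =>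
      if hB : ∃ U, P U = B then pat z (errSet pred (WU f hB.choose)) else ∅
    have : (Set.range fun U : Fin k × Fin T → ℝ => pat z (errSet pred (WU f U)))
        ⊆ h '' Set.range P := by
      rintro _ ⟨U, rfl⟩
      refine ⟨P U, ⟨U, rfl⟩, ?_⟩
      have hB : ∃ U', P U' = P U := ⟨U, rfl⟩
      simp only [h, dif_pos hB]
      exact hfac _ _ hB.choose_spec
    exact (Set.ncard_le_ncard this (Set.toFinite _)).trans (Set.ncard_image_le hFin)
  refine hle.trans ?_
  rw [Set.ncard_eq_toFinset_card _ hFin]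
  refine (halfspace_patterns v hFin.toFinset ?_).trans ?_
  · intro B hB
    simp only [Set.Finite.mem_toFinset, Set.mem_range] at hB
    obtain ⟨U, rfl⟩ := hB
    exact ⟨U, fun q => by simp [P]⟩
  · simp only [Fintype.card_prod, Fintype.card_fin]
    apply Nat.pow_le_pow_left
    have : 1 ≤ k ^ 2 * r := Nat.one_le_iff_ne_zero.2 (by positivity)
    nlinarith

lemma errSet_meas {d k : ℕ} {pred : (Fin k → Fin d → ℝ) → (Fin d → ℝ) → Fin k}
    (hp : IsPred pred) (W : Fin k → Fin d → ℝ) : MeasurableSet (errSet pred W) := by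
  have h : Measurable (pred W) := by
    refine measurable_to_countable' fun y => ?_
    have : pred W ⁻¹' {y} = {x | (∀ y', (∑ j, W y' j * x j) ≤ ∑ j, W y j * x j) ∧
      ∀ y' < y, (∑ j, W y' j * x j) < ∑ j, W y j * x j} := by
      ext x
      simp [pred_eq_iff hp]
    rw [this]
    have hm : ∀ y, Measurable fun x : Fin d → ℝ => ∑ j, W y j * x j := by
      intro y; fun_prop
    simp only [Set.ofPred_and, Set.ofPred_forall]
    refine MeasurableSet.inter (MeasurableSet.iInter fun y' => measurableSet_le (hm _) (hm _))
      (MeasurableSet.iInter fun y' => MeasurableSet.iInter fun _ =>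
        measurableSet_lt (hm _) (hm _))
  exact (measurableSet_eq_fun (h.comp measurable_fst) measurable_snd).compl

lemma proj_meas {d k T : ℕ} {pred : (Fin k → Fin d → ℝ) → (Fin d → ℝ) → Fin k}
    (hp : IsPred pred) (f : Fin T → Fin d) {ι : Type} [Fintype ι] (B : Finset ι) :
    MeasurableSet {z : ι → (Fin d → ℝ) × Fin k |
      ∃ U : Fin k × Fin T → ℝ, pat z (errSet pred (WU f U)) = B} := by
  classical
  let sc : (Fin k × Fin T → ℝ) → (Fin d → ℝ) → Fin k → ℝ := fun U x y => ∑ t, U (y, t) * x (f t)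
  let Q : (ι → Fin k) → ℕ → Set (ι → Fin d → ℝ) := fun g N =>
    {x | ∃ U : Metric.closedBall (0 : Fin k × Fin T → ℝ) N, ∀ i,
      (∀ y, sc U (x i) y ≤ sc U (x i) (g i)) ∧
      ∀ y < g i, sc U (x i) y + 1 / ((N:ℝ) + 1) ≤ sc U (x i) (g i)}
  have hQ : ∀ g N, MeasurableSet (Q g N) := by
    intro g N
    apply IsClosed.measurableSet
    let C : Set ((ι → Fin d → ℝ) × Metric.closedBall (0 : Fin k × Fin T → ℝ) N) :=
      {q | ∀ i, (∀ y, sc q.2 (q.1 i) y ≤ sc q.2 (q.1 i) (g i)) ∧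
        ∀ y < g i, sc q.2 (q.1 i) y + 1 / ((N:ℝ) + 1) ≤ sc q.2 (q.1 i) (g i)}
    have hsc : ∀ i y, Continuous fun q : (ι → Fin d → ℝ) ×
        Metric.closedBall (0 : Fin k × Fin T → ℝ) N => sc q.2 (q.1 i) y := by
      intro i y
      simp only [sc]
      refine continuous_finsetSum _ fun t _ => ?_
      refine Continuous.mul ?_ ?_
      · exact (continuous_apply (y, t)).comp (continuous_subtype_val.comp continuous_snd)
      · exact (continuous_apply (f t)).comp ((continuous_apply i).comp continuous_fst)
    have hC : IsClosed C := by
      simp only [C, Set.ofPred_and, Set.ofPred_forall]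
      refine isClosed_iInter fun i => IsClosed.inter
        (isClosed_iInter fun y => isClosed_le (hsc i y) (hsc i _))
        (isClosed_iInter fun y => isClosed_iInter fun _ =>
          isClosed_le ((hsc i y).add continuous_const) (hsc i _))
    have : CompactSpace (Metric.closedBall (0 : Fin k × Fin T → ℝ) N) :=
      isCompact_iff_compactSpace.1 (isCompact_closedBall _ _)
    have himg : Q g N = Prod.fst '' C := by
      ext x
      simp only [Q, C, Set.mem_ofPred_eq, Set.mem_image, Prod.exists, exists_and_right,
        exists_eq_right]
    rw [himg]
    exact isClosedMap_fst_of_compactSpace C hC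
  have heq : {z : ι → (Fin d → ℝ) × Fin k |
      ∃ U : Fin k × Fin T → ℝ, pat z (errSet pred (WU f U)) = B} =
      ⋃ g : ι → Fin k, ((⋃ N : ℕ, (fun (z : ι → (Fin d → ℝ) × Fin k) i => (z i).1) ⁻¹' Q g N) ∩
        ⋂ i, {z | i ∈ B ↔ g i ≠ (z i).2}) := by
    ext z
    simp only [Set.mem_ofPred_eq, Set.mem_iUnion, Set.mem_inter_iff, Set.mem_iInter,
      Set.mem_preimage]
    constructor
    · rintro ⟨U, hU⟩
      refine ⟨fun i => pred (WU f U) (z i).1, ?_, fun i => ?_⟩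
      · have hpr : ∀ i, _ := fun i => (pred_eq_iff hp (WU f U) (z i).1 _).1 rfl
        simp only [WU_score] at hpr
        have hgap : ∀ q : ι × Fin k, ∃ n : ℕ, q.2 < pred (WU f U) (z q.1).1 →
            sc U (z q.1).1 q.2 + 1 / ((n:ℝ) + 1) ≤ sc U (z q.1).1 (pred (WU f U) (z q.1).1) := by
          intro q
          by_cases h : q.2 < pred (WU f U) (z q.1).1
          · have h1 := (hpr q.1).2 q.2 h
            obtain ⟨n, hn⟩ := exists_nat_one_div_lt (sub_pos.2 h1)
            refine ⟨n, fun _ => ?_⟩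
            simp only [sc]
            linarith
          · exact ⟨0, fun h' => absurd h' h⟩
        choose n hn using hgap
        obtain ⟨M, hM⟩ := exists_nat_ge ‖U‖
        let N := M + ∑ q, n q
        refine ⟨N, ⟨⟨U, ?_⟩, fun i => ⟨fun y => (hpr i).1 y, fun y hy => ?_⟩⟩⟩
        · rw [mem_closedBall_zero_iff]
          refine hM.trans ?_
          exact_mod_cast Nat.le_add_right _ _
        · refine le_trans ?_ (hn (i, y) hy)
          have h2 : n (i, y) ≤ N := (Finset.single_le_sum (f := n) (fun _ _ => Nat.zero_le _)
            (Finset.mem_univ (i, y))).trans (Nat.le_add_left _ _)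
          have h3 : (n (i, y) : ℝ) ≤ N := by exact_mod_cast h2
          have h4 : 1 / ((N:ℝ) + 1) ≤ 1 / ((n (i, y) : ℝ) + 1) :=
            one_div_le_one_div_of_le (by positivity) (by linarith)
          simp only
          linarith
      · rw [← hU, mem_pat]; rfl
    · rintro ⟨g, ⟨N, ⟨U, hU⟩⟩, hg⟩
      refine ⟨U, ?_⟩
      ext i
      rw [mem_pat, hg]
      have : pred (WU f U) (z i).1 = g i := by
        rw [pred_eq_iff hp]
        simp only [WU_score]
        refine ⟨(hU i).1, fun y hy => ?_⟩
        have h1 := (hU i).2 y hy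
        have h2 : 0 < 1 / ((N:ℝ) + 1) := by positivity
        simp only [sc] at h1
        linarith
      simp [errSet, this]
  rw [heq]
  refine MeasurableSet.iUnion fun g => MeasurableSet.inter (MeasurableSet.iUnion fun N => ?_)
    (MeasurableSet.iInter fun i => ?_)
  · refine (measurable_pi_lambda _ fun i => ?_) (hQ g N)
    exact measurable_fst.comp (measurable_pi_apply i)
  · have h0 : MeasurableSet {z : ι → (Fin d → ℝ) × Fin k | g i = (z i).2} :=
      measurableSet_eq_fun measurable_const
        (measurable_snd.comp (measurable_pi_apply i))
    have h1 : MeasurableSet {z : ι → (Fin d → ℝ) × Fin k | g i ≠ (z i).2} := h0.compl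
    by_cases h : i ∈ B
    · simpa [h] using h1
    · simpa [h] using h0

end SMG

namespace SMG

/-- Real indicator. -/
noncomputable def iH {Ω : Type*} (H : Set Ω) (ω : Ω) : ℝ := H.indicator (fun _ => (1:ℝ)) ω

lemma iH_meas {Ω : Type*} [MeasurableSpace Ω] {H : Set Ω} (hH : MeasurableSet H) :
    Measurable (iH H) := measurable_const.indicator hH

lemma iH_mem {Ω : Type*} (H : Set Ω) (ω : Ω) : iH H ω ∈ Set.Icc (0:ℝ) 1 := by
  unfold iH
  by_cases h : ω ∈ H <;> simp [h]

lemma ind_pat {ι Ω : Type*} [Fintype ι] [DecidableEq ι] (z : ι → Ω) (H : Set Ω) (i : ι) :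
    ind (pat z H) i = iH H (z i) := by
  unfold ind iH
  by_cases h : z i ∈ H <;> simp [mem_pat, h]

lemma sum_iH {Ω : Type*} {m : ℕ} (H : Set Ω) (S : Fin m → Ω) :
    ∑ i, iH H (S i) = ({i : Fin m | S i ∈ H}.ncard : ℝ) := by
  classical
  have : {i : Fin m | S i ∈ H} = ((Finset.univ.filter fun i => S i ∈ H : Finset (Fin m)) : Set (Fin m)) := by
    ext; simp
  rw [this, Set.ncard_coe_finset, Finset.card_filter]
  push_cast
  refine Finset.sum_congr rfl fun i _ => ?_
  unfold iH
  by_cases h : S i ∈ H <;> simp [h]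

lemma cheb {Ω : Type*} [MeasurableSpace Ω] (D : Measure Ω) [IsProbabilityMeasure D]
    {H : Set Ω} (hH : MeasurableSet H) (m : ℕ) (hm : 1 ≤ m) (t : ℝ) (ht : 0 < t)
    (hmt : 1 / 2 ≤ m * t ^ 2) :
    (1:ENNReal) / 2 ≤ (Measure.pi fun _ : Fin m => D)
      {S | m * ((D H).toReal - t) < ∑ i, iH H (S i)} := by
  have hm' : (1:ℝ) ≤ m := by exact_mod_cast hm
  set μ := (Measure.pi fun _ : Fin m => D) with hμ
  have hLp : MemLp (iH H) 2 D := by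
    refine MemLp.of_bound (iH_meas hH).aestronglyMeasurable 1 (ae_of_all _ fun ω => ?_)
    have := iH_mem H ω
    rw [Real.norm_eq_abs, abs_of_nonneg this.1]; exact this.2
  have hint : ∫ ω, iH H ω ∂D = (D H).toReal := by
    unfold iH
    rw [integral_indicator_const _ hH]; simp [Measure.real]
  let Y : (Fin m → Ω) → ℝ := ∑ i, fun S => iH H (S i)
  have hY : ∀ S, Y S = ∑ i, iH H (S i) := fun S => by simp [Y]
  have hLpi : ∀ i : Fin m, MemLp (fun S : Fin m → Ω => iH H (S i)) 2 μ := fun i =>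
    hLp.comp_measurePreserving (measurePreserving_eval (fun _ : Fin m => D) i)
  have hYLp : MemLp Y 2 μ := memLp_finsetSum' _ fun i _ => hLpi i
  have hmean : ∫ S, Y S ∂μ = m * (D H).toReal := by
    simp_rw [hY]
    rw [integral_finsetSum _ fun i _ => (hLpi i).integrable (by norm_num)]
    have : ∀ i : Fin m, ∫ S, iH H (S i) ∂μ = (D H).toReal := fun i => by
      rw [← hint]
      exact integral_comp_eval (μ := fun _ : Fin m => D) (i := i) hLp.aestronglyMeasurable
    simp [this]
  have hvar : ProbabilityTheory.variance Y μ ≤ m / 4 := by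
    have h1 := ProbabilityTheory.variance_sum_pi (μ := fun _ : Fin m => D)
      (X := fun _ => iH H) (fun _ => hLp)
    change ProbabilityTheory.variance (∑ i, fun S : Fin m → Ω => iH H (S i)) μ ≤ _
    rw [hμ, h1]
    have h2 := ProbabilityTheory.variance_le_sq_of_bounded (μ := D) (a := 0) (b := 1)
      (X := iH H) (ae_of_all _ fun ω => iH_mem H ω) (iH_meas hH).aemeasurable
    simp only [Finset.sum_const, Finset.card_univ, Fintype.card_fin, nsmul_eq_mul]
    nlinarith
  have hc := ProbabilityTheory.meas_ge_le_variance_div_sq hYLp (c := m * t) (by positivity)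
  rw [hmean] at hc
  have hc2 : μ {S | m * t ≤ |Y S - m * (D H).toReal|} ≤ 1 / 2 := by
    refine hc.trans ?_
    have : ProbabilityTheory.variance Y μ / (m * t) ^ 2 ≤ 1 / 2 := by
      rw [div_le_iff₀ (by positivity)]
      nlinarith
    refine (ENNReal.ofReal_le_ofReal this).trans (le_of_eq ?_)
    rw [ENNReal.ofReal_div_of_pos (by norm_num)]; simp
  have hcov : (Set.univ : Set (Fin m → Ω)) ⊆
      {S | m * ((D H).toReal - t) < ∑ i, iH H (S i)} ∪
        {S | m * t ≤ |Y S - m * (D H).toReal|} := by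
    intro S _
    by_cases h : m * ((D H).toReal - t) < ∑ i, iH H (S i)
    · exact Or.inl h
    · right
      push Not at h
      change m * t ≤ |Y S - m * (D H).toReal|
      rw [hY]
      refine le_trans ?_ (neg_le_abs _)
      linarith
  have h1 : (1:ENNReal) ≤ μ {S | m * ((D H).toReal - t) < ∑ i, iH H (S i)} + 1 / 2 := by
    calc (1:ENNReal) = μ Set.univ := by rw [measure_univ]
      _ ≤ _ := (measure_mono hcov).trans (measure_union_le _ _)
      _ ≤ _ := by gcongr
  have h2 : (1:ENNReal) / 2 = 1 - 1 / 2 := by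
    rw [one_div]; exact ENNReal.one_sub_inv_two.symm
  rw [h2]
  exact tsub_le_iff_right.2 h1

/-- Points of a double sample. -/
def pt {Ω : Type*} {m : ℕ} (Z : Fin m → Ω × Ω) (q : Fin m × Bool) : Ω :=
  if q.2 then (Z q.1).2 else (Z q.1).1

/-- Swapping of a double sample. -/
def sw {Ω : Type*} {m : ℕ} (σ : Fin m → Bool) (Z : Fin m → Ω × Ω) (i : Fin m) : Ω × Ω :=
  if σ i then Z i else (Z i).swap

lemma sw_mp {Ω : Type*} [MeasurableSpace Ω] (D : Measure Ω) [IsProbabilityMeasure D] {m : ℕ}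
    (σ : Fin m → Bool) : MeasurePreserving (sw (Ω := Ω) σ)
      (Measure.pi fun _ : Fin m => D.prod D) (Measure.pi fun _ : Fin m => D.prod D) := by
  have := measurePreserving_pi (fun _ : Fin m => D.prod D) (fun _ : Fin m => D.prod D)
    (f := fun i (p : Ω × Ω) => if σ i then p else p.swap) (fun i => by
      by_cases h : σ i
      · simp only [h, if_true]; exact MeasurePreserving.id _
      · simp only [h]; exact Measure.measurePreserving_swap)
  exact this

lemma sum_sw {Ω : Type*} {m : ℕ} (σ : Fin m → Bool) (Z : Fin m → Ω × Ω) (H : Set Ω) :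
    ∑ i, (iH H (sw σ Z i).2 - iH H (sw σ Z i).1) = X σ (pat (pt Z) H) := by
  unfold X
  refine Finset.sum_congr rfl fun i _ => ?_
  rw [ind_pat, ind_pat]
  by_cases h : σ i <;> simp [sw, pt, sg, h]

lemma sym_meas {Ω P : Type*} [MeasurableSpace Ω] (H : P → Set Ω) (m : ℕ)
    (hproj : ∀ B : Finset (Fin m × Bool),
      MeasurableSet {z : Fin m × Bool → Ω | ∃ p, pat z (H p) = B}) (s : ℝ) :
    MeasurableSet {Z : Fin m → Ω × Ω | ∃ p, s < ∑ i, (iH (H p) (Z i).2 - iH (H p) (Z i).1)} := by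
  classical
  have heq : {Z : Fin m → Ω × Ω | ∃ p, s < ∑ i, (iH (H p) (Z i).2 - iH (H p) (Z i).1)} =
      ⋃ B : Finset (Fin m × Bool), ⋃ _ : s < X (fun _ => true) B,
        pt ⁻¹' {z : Fin m × Bool → Ω | ∃ p, pat z (H p) = B} := by
    have h1 : ∀ Z p, ∑ i, (iH (H p) (Z i).2 - iH (H p) (Z i).1)
        = X (fun _ : Fin m => true) (pat (pt Z) (H p)) := by
      intro Z p
      rw [← sum_sw]; simp [sw]
    ext Z
    simp only [h1, Set.mem_ofPred_eq, Set.mem_iUnion, Set.mem_preimage]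
    constructor
    · rintro ⟨p, hp⟩; exact ⟨_, hp, p, rfl⟩
    · rintro ⟨B, hB, p, rfl⟩; exact ⟨p, hB⟩
  rw [heq]
  refine MeasurableSet.iUnion fun B => MeasurableSet.iUnion fun _ => ?_
  refine (measurable_pi_lambda _ fun q => ?_) (hproj B)
  by_cases h : q.2
  · simp only [pt, h, if_true]; exact measurable_snd.comp (measurable_pi_apply _)
  · simp only [pt, h]; exact measurable_fst.comp (measurable_pi_apply _)

lemma sym1 {Ω P : Type*} [MeasurableSpace Ω] (D : Measure Ω) [IsProbabilityMeasure D]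
    (H : P → Set Ω) (m : ℕ) (hm : 1 ≤ m)
    (hproj : ∀ B : Finset (Fin m × Bool),
      MeasurableSet {z : Fin m × Bool → Ω | ∃ p, pat z (H p) = B})
    (A V : ℕ) (hA : 1 ≤ A) (hV : 1 ≤ V)
    (hgr : ∀ r : ℕ, 1 ≤ r → ∀ z : Fin r → Ω,
      (Set.range fun p => pat z (H p)).ncard ≤ (A * r) ^ V)
    (δ : ℝ) (hδ : 0 < δ) (hδ1 : δ < 1) :
    (Measure.pi fun _ : Fin m => D.prod D) {Z | ∃ p,
      32 * Real.sqrt (m * (2 * V * Real.log (6 * A * V) + Real.log (1 / δ))) <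
        ∑ i, (iH (H p) (Z i).2 - iH (H p) (Z i).1)} ≤ ENNReal.ofReal δ := by
  classical
  set s := 32 * Real.sqrt (m * (2 * V * Real.log (6 * A * V) + Real.log (1 / δ))) with hs
  set Bs := {Z : Fin m → Ω × Ω | ∃ p, s < ∑ i, (iH (H p) (Z i).2 - iH (H p) (Z i).1)} with hBs
  set μ := (Measure.pi fun _ : Fin m => D.prod D) with hμ
  have hmeas : MeasurableSet Bs := sym_meas H m hproj s
  have hpt : ∀ Z : Fin m → Ω × Ω,
      ((Finset.univ.filter fun σ : Fin m → Bool => sw σ Z ∈ Bs).card : ℝ) ≤ δ * 2 ^ m := by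
    intro Z
    have hfin : (Set.range fun p => pat (pt Z) (H p)).Finite := Set.toFinite _
    have := chaining m hm hfin.toFinset A V hA hV (fun r hr x => by
      refine le_trans ?_ (hgr r hr (pt Z ∘ x))
      rw [← Set.ncard_coe_finset]
      apply Set.ncard_le_ncard _ (Set.toFinite _)
      intro B hB
      simp only [Finset.coe_image, Set.Finite.coe_toFinset, Set.mem_image, Set.mem_range] at hB
      obtain ⟨_, ⟨p, rfl⟩, rfl⟩ := hB
      refine ⟨p, ?_⟩
      ext i
      simp [mem_pat, tr]) δ hδ hδ1
    refine le_trans (le_of_eq ?_) this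
    congr 2
    ext σ
    simp only [hBs, Set.mem_ofPred_eq, Set.Finite.mem_toFinset, Set.mem_range,
      exists_exists_eq_and, sum_sw, Finset.mem_filter, Finset.mem_univ, true_and, ← hs]
  have h1 : ∀ σ : Fin m → Bool, μ Bs = ∫⁻ Z, (sw σ ⁻¹' Bs).indicator 1 Z ∂μ := by
    intro σ
    rw [lintegral_indicator_one ((sw_mp D σ).measurable hmeas),
      (sw_mp D σ).measure_preimage hmeas.nullMeasurableSet]
  have h2 : (2:ENNReal) ^ m * μ Bs = ∫⁻ Z, ∑ σ : Fin m → Bool, (sw σ ⁻¹' Bs).indicator 1 Z ∂μ := by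
    rw [lintegral_finsetSum _ fun σ _ =>
      measurable_one.indicator ((sw_mp D σ).measurable hmeas)]
    rw [← Finset.sum_congr rfl fun σ _ => h1 σ]
    simp
  have h3 : ∫⁻ Z, ∑ σ : Fin m → Bool, (sw σ ⁻¹' Bs).indicator 1 Z ∂μ
      ≤ ∫⁻ _, ENNReal.ofReal (δ * 2 ^ m) ∂μ := by
    refine lintegral_mono fun Z => ?_
    have : ∑ σ : Fin m → Bool, (sw σ ⁻¹' Bs).indicator (1 : (Fin m → Ω × Ω) → ENNReal) Z
        = ((Finset.univ.filter fun σ : Fin m → Bool => sw σ Z ∈ Bs).card : ENNReal) := by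
      rw [Finset.card_filter]
      push_cast
      refine Finset.sum_congr rfl fun σ _ => ?_
      simp [Set.indicator_apply]
    rw [this, ← ENNReal.ofReal_natCast]
    exact ENNReal.ofReal_le_ofReal (hpt Z)
  rw [lintegral_const, measure_univ, mul_one, ← h2, mul_comm δ, ENNReal.ofReal_mul (by positivity)]
    at h3
  rw [ENNReal.ofReal_pow (by norm_num), ENNReal.ofReal_ofNat] at h3
  exact (ENNReal.mul_le_mul_iff_right (by simp) (by simp)).1 h3

lemma gen {Ω P : Type*} [MeasurableSpace Ω] (D : Measure Ω) [IsProbabilityMeasure D]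
    (H : P → Set Ω) (hH : ∀ p, MeasurableSet (H p)) (m : ℕ) (hm : 1 ≤ m)
    (hproj : ∀ B : Finset (Fin m × Bool),
      MeasurableSet {z : Fin m × Bool → Ω | ∃ p, pat z (H p) = B})
    (A V : ℕ) (hA : 1 ≤ A) (hV : 1 ≤ V)
    (hgr : ∀ r : ℕ, 1 ≤ r → ∀ z : Fin r → Ω,
      (Set.range fun p => pat z (H p)).ncard ≤ (A * r) ^ V)
    (δ : ℝ) (hδ : 0 < δ) (hδ1 : δ < 1) :
    (Measure.pi fun _ : Fin m => D) {S | ∃ p,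
      (1 / (m:ℝ)) * ({i : Fin m | S i ∈ H p}.ncard : ℝ) +
      64 * Real.sqrt ((2 * V * Real.log (6 * A * V) + Real.log (2 / δ)) / m) < (D (H p)).toReal}
      ≤ ENNReal.ofReal δ := by
  have hm' : (1:ℝ) ≤ m := by exact_mod_cast hm
  have hA' : (1:ℝ) ≤ A := by exact_mod_cast hA
  have hV' : (1:ℝ) ≤ V := by exact_mod_cast hV
  have hAV : (1:ℝ) ≤ A * V := by nlinarith
  have hlogK : 1 ≤ Real.log (6 * A * V) := by
    rw [Real.le_log_iff_exp_le (by positivity)]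
    refine (Real.exp_one_lt_d9.trans (by norm_num : _ < (6:ℝ))).le.trans ?_
    nlinarith
  have hlogd : 0 < Real.log (2 / δ) := Real.log_pos (by rw [lt_div_iff₀ hδ]; linarith)
  have h1 := sym1 D H m hm hproj A V hA hV hgr (δ/2) (by linarith) (by linarith)
  rw [show 1 / (δ / 2) = 2 / δ by field_simp] at h1
  set E := 2 * V * Real.log (6 * A * V) + Real.log (2 / δ) with hE
  have hE1 : 1 ≤ E := by nlinarith
  set t := 32 * Real.sqrt (E / m) with ht
  have hq : 0 < Real.sqrt (E / m) := Real.sqrt_pos.2 (by positivity)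
  have ht0 : 0 < t := by positivity
  have hqq : Real.sqrt (E / m) ^ 2 = E / m := Real.sq_sqrt (by positivity)
  have hmt : m * t ^ 2 = 1024 * E := by
    rw [ht, mul_pow, hqq]; field_simp; norm_num
  have hst : 32 * Real.sqrt (m * E) = m * t := by
    have : (m:ℝ) * E = m ^ 2 * (E / m) := by field_simp
    rw [this, Real.sqrt_mul (by positivity), Real.sqrt_sq (by positivity), ht]; ring
  rw [hst] at h1
  set Bs := {Z : Fin m → Ω × Ω | ∃ p, m * t < ∑ i, (iH (H p) (Z i).2 - iH (H p) (Z i).1)} with hBs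
  have hmeas : MeasurableSet Bs := sym_meas H m hproj _
  set μ := Measure.pi fun _ : Fin m => D with hμ
  let e := MeasurableEquiv.arrowProdEquivProdArrow Ω Ω (Fin m)
  have he : MeasurePreserving e (Measure.pi fun _ : Fin m => D.prod D) (μ.prod μ) :=
    measurePreserving_arrowProdEquivProdArrow Ω Ω (Fin m) (fun _ => D) (fun _ => D)
  let Bs' := e.symm ⁻¹' Bs
  have hmeas' : MeasurableSet Bs' := e.symm.measurable hmeas
  have h2 : (μ.prod μ) Bs' ≤ ENNReal.ofReal (δ/2) := by
    rw [← he.measure_preimage hmeas'.nullMeasurableSet]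
    refine le_trans (le_of_eq ?_) h1
    congr 1
  rw [Measure.prod_apply hmeas'] at h2
  have h3 := mul_meas_ge_le_lintegral (μ := μ) (measurable_measure_prodMk_left (ν := μ) hmeas') (1/2)
  have h4 : {S | ∃ p, (1 / (m:ℝ)) * ({i : Fin m | S i ∈ H p}.ncard : ℝ) +
      64 * Real.sqrt (E / m) < (D (H p)).toReal} ⊆
      {S | (1:ENNReal)/2 ≤ μ (Prod.mk S ⁻¹' Bs')} := by
    rintro S ⟨p, hp⟩
    refine (cheb D (hH p) m hm t ht0 (by rw [hmt]; linarith)).trans (measure_mono ?_)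
    intro S' hS'
    change m * ((D (H p)).toReal - t) < ∑ i, iH (H p) (S' i) at hS'
    change ∃ p, m * t < ∑ i, (iH (H p) (S' i) - iH (H p) (S i))
    refine ⟨p, ?_⟩
    rw [Finset.sum_sub_distrib, sum_iH (H p) S]
    have h5 : (m:ℝ) * ((1 / (m:ℝ)) * ({i : Fin m | S i ∈ H p}.ncard : ℝ) +
      64 * Real.sqrt (E / m)) < m * (D (H p)).toReal := mul_lt_mul_of_pos_left hp (by linarith)
    have h6 : (m:ℝ) * ((1 / (m:ℝ)) * ({i : Fin m | S i ∈ H p}.ncard : ℝ) +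
      64 * Real.sqrt (E / m)) = ({i : Fin m | S i ∈ H p}.ncard : ℝ) + m * (2 * t) := by
      rw [ht]; field_simp; ring
    linarith
  have h7 : (1/2 : ENNReal) * μ {S | ∃ p, (1 / (m:ℝ)) * ({i : Fin m | S i ∈ H p}.ncard : ℝ) +
      64 * Real.sqrt (E / m) < (D (H p)).toReal} ≤ ENNReal.ofReal (δ/2) :=
    (by gcongr : _ ≤ _).trans (h3.trans h2)
  have h8 : ENNReal.ofReal (δ/2) = 1/2 * ENNReal.ofReal δ := by
    rw [ENNReal.ofReal_div_of_pos (by norm_num), ENNReal.div_eq_inv_mul, one_div]; simp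
  rw [h8] at h7
  exact (ENNReal.mul_le_mul_iff_right (by simp) (by simp)).1 h7

end SMG

namespace SMG

lemma sparse_param {d k T : ℕ} (hd : 1 ≤ d) (hT : 1 ≤ T) (W : Fin k → Fin d → ℝ)
    (hW : {r : Fin d | ∃ q, W q r ≠ 0}.ncard ≤ T) :
    ∃ (f : Fin T → Fin d) (U : Fin k × Fin T → ℝ), WU f U = W := by
  classical
  set s : Finset (Fin d) := Finset.univ.filter fun r => ∃ q, W q r ≠ 0 with hs
  have hcard : s.card ≤ T := by
    rw [← Set.ncard_coe_finset]
    convert hW using 2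
    ext r; simp [hs]
  obtain ⟨e⟩ : Nonempty (s ↪ Fin T) := by
    apply Function.Embedding.nonempty_of_card_le
    simpa using hcard
  let g : Fin d → Fin T := fun j => if h : j ∈ s then e ⟨j, h⟩ else ⟨0, hT⟩
  let f : Fin T → Fin d := fun t => if h : ∃ j : s, e j = t then (h.choose : Fin d) else ⟨0, hd⟩
  have hfg : ∀ j ∈ s, f (g j) = j := by
    intro j hj
    have h : ∃ i : s, e i = g j := ⟨⟨j, hj⟩, by simp [g, hj]⟩
    have h2 : e h.choose = e ⟨j, hj⟩ := by
      rw [h.choose_spec]; simp [g, hj]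
    have h3 := e.injective h2
    simp only [f, dif_pos h]
    rw [h3]
  refine ⟨f, fun a => if g (f a.2) = a.2 then W a.1 (f a.2) else 0, ?_⟩
  ext y j
  simp only [WU]
  by_cases hj : j ∈ s
  · rw [Finset.sum_eq_single (g j)]
    · simp [hfg j hj]
    · intro t _ ht
      by_cases h : f t = j
      · subst h
        simp [Ne.symm ht]
      · simp [h]
    · simp
  · have h0 : W y j = 0 := by
      by_contra h
      exact hj (by simp only [hs, Finset.mem_filter, Finset.mem_univ, true_and]; exact ⟨y, h⟩)
    rw [h0]
    refine Finset.sum_eq_zero fun t _ => ?_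
    by_cases h : f t = j
    · subst h; simp [h0]
    · simp [h]

lemma const_bound (d k T : ℕ) (hd : 1 ≤ d) (hk : 2 ≤ k) (hT : 1 ≤ T) (δ : ℝ) (hδ : 0 < δ)
    (hδ1 : δ < 1) :
    2 * ((k * T : ℕ) : ℝ) * Real.log (6 * (2 * k ^ 2 : ℕ) * (k * T : ℕ)) +
      Real.log (2 / (δ / d ^ T)) ≤
    25 * ((T : ℝ) * k * Real.log ((T : ℝ) * k) * Real.log k + (T : ℝ) * Real.log d +
      Real.log (1 / δ)) := by
  have hd' : (1:ℝ) ≤ d := by exact_mod_cast hd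
  have hk' : (2:ℝ) ≤ k := by exact_mod_cast hk
  have hT' : (1:ℝ) ≤ T := by exact_mod_cast hT
  set n : ℝ := (T:ℝ) * k with hn
  have hn2 : 2 ≤ n := by nlinarith
  have hkn : (k:ℝ) ≤ n := by nlinarith
  have l2a := Real.log_two_gt_d9
  have l2b := Real.log_two_lt_d9
  have hlk : Real.log 2 ≤ Real.log k := Real.log_le_log (by norm_num) hk'
  have hln : Real.log 2 ≤ Real.log n := Real.log_le_log (by norm_num) hn2
  have e1 : Real.log (6 * (2 * k ^ 2 : ℕ) * (k * T : ℕ)) ≤ 7 * Real.log n := by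
    have : (7:ℝ) * Real.log n = Real.log (n ^ 7) := by rw [Real.log_pow]; norm_num
    rw [this]
    apply Real.log_le_log (by positivity)
    push_cast
    have a1 : (k:ℝ)^2 ≤ n^2 := by gcongr
    have a2 : (2:ℝ)^4 ≤ n^4 := by gcongr
    calc (6:ℝ) * (2 * k^2) * (k * T) = 12 * k^2 * n := by rw [hn]; ring
      _ ≤ n^4 * n^2 * n := by gcongr; linarith
      _ = n^7 := by ring
  have e2 : Real.log (2 / (δ / d ^ T)) = Real.log 2 + T * Real.log d + Real.log (1/δ) := by
    have : 2 / (δ / (d:ℝ) ^ T) = 2 * d ^ T * (1/δ) := by field_simp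
    rw [this, Real.log_mul (by positivity) (by positivity),
      Real.log_mul (by positivity) (by positivity), Real.log_pow]
  have hld : 0 ≤ Real.log d := Real.log_nonneg hd'
  have hlδ : 0 < Real.log (1/δ) := Real.log_pos (by rw [lt_div_iff₀ hδ]; linarith)
  have e3 : ((k * T : ℕ) : ℝ) = n := by push_cast; rw [hn]; ring
  rw [e2, e3]
  rw [e3] at e1
  have hTd : 0 ≤ (T:ℝ) * Real.log d := by positivity
  have p1 : 2 * Real.log 2 ≤ n * Real.log n :=
    mul_le_mul hn2 hln (by linarith) (by linarith)
  have p2 : 2 * n * Real.log (6 * (2 * k ^ 2 : ℕ) * n) ≤ 14 * (n * Real.log n) := by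
    have := mul_le_mul_of_nonneg_left e1 (show 0 ≤ 2 * n by linarith)
    linarith
  have p3 : n * Real.log n * 0.69 ≤ n * Real.log n * Real.log k :=
    mul_le_mul_of_nonneg_left (by linarith) (by linarith)
  linarith

end SMG

/-- **Theorem 1 (generalization bound for column-sparse multiclass predictors).**
There is a universal constant `C > 0` such that for any distribution `D` over
`[-1,1]^d × {1,…,k}`, with probability at least `1 - δ` over an i.i.d. sample of size `m`,
every matrix `W` with at most `T` nonzero columns has true 0–1 error at most its empirical
0–1 error plus `C √((T k log(Tk) log k + T log d + log(1/δ)) / m)`. Here `pred` is the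
predictor `h_W(x) = argmax_y (Wx)_y`, ties broken towards the smallest index. -/
theorem sparse_multiclass_generalization_bound :
    ∃ C : ℝ, 0 < C ∧
      ∀ (d k T m : ℕ), 1 ≤ d → 1 ≤ k → 1 ≤ T → 1 ≤ m →
      ∀ δ : ℝ, 0 < δ → δ < 1 →
      ∀ (D : Measure ((Fin d → ℝ) × Fin k)) [IsProbabilityMeasure D],
      (∀ᵐ p ∂D, ∀ j : Fin d, |p.1 j| ≤ 1) →
      ∀ pred : (Fin k → Fin d → ℝ) → (Fin d → ℝ) → Fin k,
      (∀ (W : Fin k → Fin d → ℝ) (x : Fin d → ℝ),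
        (∀ y : Fin k, (∑ j, W y j * x j) ≤ ∑ j, W (pred W x) j * x j) ∧
        (∀ y : Fin k, (∀ y' : Fin k, (∑ j, W y' j * x j) ≤ ∑ j, W y j * x j) →
          pred W x ≤ y)) →
      ENNReal.ofReal (1 - δ) ≤
        (Measure.pi fun _ : Fin m => D)
          {S : Fin m → (Fin d → ℝ) × Fin k |
            ∀ W : Fin k → Fin d → ℝ,
              {r : Fin d | ∃ q, W q r ≠ 0}.ncard ≤ T →
              (D {p : (Fin d → ℝ) × Fin k | pred W p.1 ≠ p.2}).toReal ≤
                (1 / (m : ℝ)) * ({i : Fin m | pred W (S i).1 ≠ (S i).2}.ncard : ℝ) +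
                  C * Real.sqrt
                    (((T : ℝ) * k * Real.log ((T : ℝ) * k) * Real.log k +
                        (T : ℝ) * Real.log d + Real.log (1 / δ)) / (m : ℝ))} := by
  refine ⟨320, by norm_num, ?_⟩
  intro d k T m hd hk hT hm δ hδ hδ1 D _ _ pred hp
  set μ := (Measure.pi fun _ : Fin m => D) with hμ
  set R := Real.sqrt
    (((T : ℝ) * k * Real.log ((T : ℝ) * k) * Real.log k +
      (T : ℝ) * Real.log d + Real.log (1 / δ)) / (m : ℝ)) with hR
  have hR0 : 0 ≤ R := Real.sqrt_nonneg _
  set G := {S : Fin m → (Fin d → ℝ) × Fin k | ∀ W : Fin k → Fin d → ℝ,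
    {r : Fin d | ∃ q, W q r ≠ 0}.ncard ≤ T →
    (D {p : (Fin d → ℝ) × Fin k | pred W p.1 ≠ p.2}).toReal ≤
      (1 / (m : ℝ)) * ({i : Fin m | pred W (S i).1 ≠ (S i).2}.ncard : ℝ) + 320 * R} with hG
  suffices hbad : μ Gᶜ ≤ ENNReal.ofReal δ by
    rw [ENNReal.ofReal_sub _ hδ.le, ENNReal.ofReal_one, tsub_le_iff_right]
    calc (1:ENNReal) = μ (G ∪ Gᶜ) := by rw [Set.union_compl_self, measure_univ]
      _ ≤ μ G + μ Gᶜ := measure_union_le _ _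
      _ ≤ _ := by gcongr
  rcases Nat.lt_or_ge k 2 with hk1 | hk2
  · have hk1' : k = 1 := by omega
    subst hk1'
    have : Gᶜ = ∅ := by
      rw [Set.compl_empty_iff, Set.eq_univ_iff_forall]
      intro S W _
      have h0 : {p : (Fin d → ℝ) × Fin 1 | pred W p.1 ≠ p.2} = ∅ := by
        ext p; simp [Subsingleton.elim (pred W p.1) p.2]
      rw [h0]
      simp only [measure_empty, ENNReal.toReal_zero]
      positivity
    rw [this]; simp
  have hcb := SMG.const_bound d k T hd hk2 hT δ hδ hδ1
  have hm' : (1:ℝ) ≤ m := by exact_mod_cast hm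
  have hd' : (1:ℝ) ≤ d := by exact_mod_cast hd
  have hdT : (1:ℝ) ≤ (d:ℝ) ^ T := one_le_pow₀ hd'
  set δ' := δ / (d:ℝ) ^ T with hδ'
  have hδ'0 : 0 < δ' := by positivity
  have hδ'1 : δ' < 1 := (div_le_self hδ.le hdT).trans_lt hδ1
  have hsq : 64 * Real.sqrt ((2 * ((k * T : ℕ) : ℝ) *
      Real.log (6 * (2 * k ^ 2 : ℕ) * (k * T : ℕ)) + Real.log (2 / δ')) / m) ≤ 320 * R := by
    have h1 : Real.sqrt ((2 * ((k * T : ℕ) : ℝ) *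
      Real.log (6 * (2 * k ^ 2 : ℕ) * (k * T : ℕ)) + Real.log (2 / δ')) / m) ≤ 5 * R := by
      rw [hR, show (5:ℝ) = Real.sqrt (5 ^ 2) from (Real.sqrt_sq (by norm_num)).symm,
        ← Real.sqrt_mul (by positivity)]
      apply Real.sqrt_le_sqrt
      rw [← mul_div_assoc]
      apply div_le_div_of_nonneg_right _ (by linarith)
      norm_num at hcb ⊢
      linarith
    linarith
  let bad : (Fin T → Fin d) → Set (Fin m → (Fin d → ℝ) × Fin k) := fun f =>
    {S | ∃ U : Fin k × Fin T → ℝ,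
      (1 / (m:ℝ)) * ({i : Fin m | S i ∈ SMG.errSet pred (SMG.WU f U)}.ncard : ℝ) +
      64 * Real.sqrt ((2 * ((k * T : ℕ) : ℝ) * Real.log (6 * (2 * k ^ 2 : ℕ) * (k * T : ℕ)) +
        Real.log (2 / δ')) / m) < (D (SMG.errSet pred (SMG.WU f U))).toReal}
  have hbadf : ∀ f, μ (bad f) ≤ ENNReal.ofReal δ' := fun f =>
    SMG.gen D (fun U : Fin k × Fin T → ℝ => SMG.errSet pred (SMG.WU f U))
      (fun U => SMG.errSet_meas hp _) m hm (fun B => SMG.proj_meas hp f B) (2 * k ^ 2) (k * T)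
      (Nat.one_le_iff_ne_zero.2 (by positivity)) (Nat.one_le_iff_ne_zero.2 (by positivity))
      (fun r hr z => SMG.growth hk hp f r hr z) δ' hδ'0 hδ'1
  have hcov : Gᶜ ⊆ ⋃ f, bad f := by
    intro S hS
    simp only [hG, Set.mem_compl_iff, Set.mem_ofPred_eq, not_forall, not_le] at hS
    obtain ⟨W, hW, hlt⟩ := hS
    obtain ⟨f, U, rfl⟩ := SMG.sparse_param hd hT W hW
    refine Set.mem_iUnion.2 ⟨f, U, ?_⟩
    refine lt_of_le_of_lt ?_ hlt
    exact add_le_add le_rfl hsq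
  calc μ Gᶜ ≤ ∑ f, μ (bad f) := (measure_mono hcov).trans (measure_iUnion_fintype_le _ _)
    _ ≤ ∑ _f : Fin T → Fin d, ENNReal.ofReal δ' := Finset.sum_le_sum fun f _ => hbadf f
    _ = ENNReal.ofReal δ := by
      rw [Finset.sum_const, Finset.card_univ, Fintype.card_fun, Fintype.card_fin,
        Fintype.card_fin, nsmul_eq_mul, ← ENNReal.ofReal_natCast,
        ← ENNReal.ofReal_mul (by positivity)]
      congr 1
      rw [hδ']; push_cast; field_simp
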